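/- Quantitative frequency-mismatch obstruction (quantitative form of Lemma 2.4(i)): Let N ≥ 1, μ ∈ ℝ, ε ≥ 0, M > 0, and let ω : ℝ³ → ℝ. Suppose r ∈ ℝ^N, φ ∈ ℝ^{N−1}, ρ ∈ ℝ satisfy, with the conventions (r_0, φ_0) := (r_1, 0) and (r_{N+1}, φ_N) := (r_N, 0), the phase equations 0 = (ω(r_n, μ, ε) − ρ) r_n + ε (r_{n+1} sin φ_n − r_{n−1} sin φ_{n−1}) for all 1 ≤ n ≤ N, and that |r_n| ≤ M for all n. If r_i = a > 0 and r_j = b > 0 for some indices i, j, then |ω(a, μ, ε) − ω(b, μ, ε)| ≤ 2 ε M (1/a + 1/b). In particular, solutions with amplitudes a = r_+(μ) and b = r_−(μ) and uniformly bounded components cannot exist for sufficiently small ε > 0 when ω(r_+(μ), μ, ·) and ω(r_−(μ), μ, ·) stay a fixed distance apart. -/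

import Mathlib

noncomputable section

open Set

/-- Extension of the amplitude sequence by the off-site boundary conventions
`r 0 := r 1` and `r (N+1) := r N`. -/
def extR (N : ℕ) (r : ℕ → ℝ) (n : ℕ) : ℝ :=
  if n = 0 then r 1 else if n = N + 1 then r N else r n

/-- Extension of the phase-difference sequence by the off-site boundary
conventions `φ 0 := 0` and `φ N := 0`. -/
def extPhi (N : ℕ) (φ : ℕ → ℝ) (n : ℕ) : ℝ :=
  if n = 0 then 0 else if n = N then 0 else φ n

/-- The extended amplitudes obey the same bound as the amplitudes themselves. -/
lemma abs_extR_le {N : ℕ} (hN : 1 ≤ N) {r : ℕ → ℝ} {M : ℝ}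
    (hr : ∀ n, 1 ≤ n → n ≤ N → |r n| ≤ M) {n : ℕ} (hn : n ≤ N + 1) :
    |extR N r n| ≤ M := by
  unfold extR
  split_ifs with h₀ h₁
  · exact hr 1 le_rfl hN
  · exact hr N hN le_rfl
  · exact hr n (by omega) (by omega)

lemma abs_mul_sin_le {x M : ℝ} (hx : |x| ≤ M) (t : ℝ) : |x * Real.sin t| ≤ M := by
  rw [abs_mul]
  exact (mul_le_of_le_one_right (abs_nonneg x) (Real.abs_sin_le_one t)).trans hx

/-- If `w * a` is balanced by a coupling term `ε * (x - y)` with `|x|, |y| ≤ M`, then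
`|w| ≤ 2εM / a`. -/
lemma abs_le_of_mul_add_coupling_eq_zero {w a ε x y M : ℝ} (ha : 0 < a) (hε : 0 ≤ ε)
    (hx : |x| ≤ M) (hy : |y| ≤ M) (h : w * a + ε * (x - y) = 0) :
    |w| ≤ 2 * ε * M * (1 / a) := by
  rw [mul_one_div, le_div_iff₀ ha]
  calc |w| * a = |w * a| := by rw [abs_mul, abs_of_pos ha]
    _ = ε * |x - y| := by
      rw [eq_neg_of_add_eq_zero_left h, abs_neg, abs_mul, abs_of_nonneg hε]
    _ ≤ ε * (M + M) := by
      gcongr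
      exact (abs_sub x y).trans (add_le_add hx hy)
    _ = 2 * ε * M := by ring

/-- Quantitative frequency-mismatch obstruction (quantitative form of
Lemma 2.4(i)): if `(r, φ, ρ)` satisfies the phase equations of the
dissipatively coupled chain with `|r_n| ≤ M`, and two nodes carry positive
amplitudes `a` and `b`, then `|ω(a,μ,ε) − ω(b,μ,ε)| ≤ 2εM(1/a + 1/b)`. -/
theorem quantitative_frequency_mismatch
    (N : ℕ) (hN : 1 ≤ N) (μ ε M : ℝ) (hε : 0 ≤ ε) (hM : 0 < M)
    (om : ℝ → ℝ → ℝ → ℝ) (r φ : ℕ → ℝ) (ρ : ℝ)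
    (heq : ∀ n, 1 ≤ n → n ≤ N →
      (om (r n) μ ε - ρ) * r n
        + ε * (extR N r (n + 1) * Real.sin (extPhi N φ n)
            - extR N r (n - 1) * Real.sin (extPhi N φ (n - 1))) = 0)
    (hbound : ∀ n, 1 ≤ n → n ≤ N → |r n| ≤ M)
    (i j : ℕ) (hi1 : 1 ≤ i) (hiN : i ≤ N) (hj1 : 1 ≤ j) (hjN : j ≤ N)
    (a b : ℝ) (ha : 0 < a) (hb : 0 < b) (hra : r i = a) (hrb : r j = b) :
    |om a μ ε - om b μ ε| ≤ 2 * ε * M * (1 / a + 1 / b) := by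
  have key : ∀ n, 1 ≤ n → n ≤ N → 0 < r n →
      |om (r n) μ ε - ρ| ≤ 2 * ε * M * (1 / r n) := fun n h1 hn hpos =>
    abs_le_of_mul_add_coupling_eq_zero hpos hε
      (abs_mul_sin_le (abs_extR_le hN hbound (by omega)) _)
      (abs_mul_sin_le (abs_extR_le hN hbound (by omega)) _) (heq n h1 hn)
  subst hra hrb
  calc |om (r i) μ ε - om (r j) μ ε|
      ≤ |om (r i) μ ε - ρ| + |ρ - om (r j) μ ε| := abs_sub_le _ _ _
    _ ≤ 2 * ε * M * (1 / r i) + 2 * ε * M * (1 / r j) := by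
      rw [abs_sub_comm ρ]
      exact add_le_add (key i hi1 hiN ha) (key j hj1 hjN hb)
    _ = 2 * ε * M * (1 / r i + 1 / r j) := by ring
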